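/- Let 0<r<1 and let T be a bounded linear operator on a complex Hilbert space H belonging to the class C_α, with defect operator D. Then the output transform is contractive: for every x ∈ H, (1−r²)^{−1} ∑_{n=0}^{∞} ‖DTⁿx‖² + (1−r²)^{−1} ∑_{n=1}^{∞} r^{2n−2}‖DT^{−n}x‖² ≤ ‖x‖². -/

import Mathlib

open ContinuousLinearMap

/-- The operator `α(T*,T) = -T*²T² + (1+r²)T*T - r²I`. -/
noncomputable def alphaOp {H : Type*} [NormedAddCommGroup H] [InnerProductSpace ℂ H]
    [CompleteSpace H] (r : ℝ) (T : H →L[ℂ] H) : H →L[ℂ] H :=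
  -((adjoint T) ^ 2 * T ^ 2) + ((1 + r ^ 2 : ℝ) : ℂ) • (adjoint T * T)
    - ((r ^ 2 : ℝ) : ℂ) • (1 : H →L[ℂ] H)

theorem aux_tele (q : ℝ) (hq1 : q ≤ 1) (u d : ℕ → ℝ) (hu : ∀ n, 0 ≤ u n)
    (hd : ∀ n, 0 ≤ d n)
    (h : ∀ n, d n = (u (n + 1) - q * u n) - (u (n + 2) - q * u (n + 1))) :
    ∃ s, HasSum d s ∧ s ≤ u 1 - q * u 0 := by
  have hw : Antitone (fun n => u (n + 1) - q * u n) := by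
    apply antitone_nat_of_succ_le
    intro n
    have h1 := h n
    have h2 := hd n
    simp only [add_assoc, Nat.reduceAdd] at *
    linarith
  have hpos : ∀ n, 0 ≤ u (n + 1) - q * u n := by
    intro M
    by_contra hM
    push Not at hM
    have key : ∀ k : ℕ, u (M + k) ≤ u M + k * (u (M + 1) - q * u M) := by
      intro k
      induction k with
      | zero => simp
      | succ k ih =>
        have h1 : u (M + k + 1) - q * u (M + k) ≤ u (M + 1) - q * u M :=
          hw (Nat.le_add_right M k)
        have h2 := mul_le_mul_of_nonneg_right hq1 (hu (M + k))
        rw [← add_assoc]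
        push_cast
        linarith
    obtain ⟨k, hk⟩ := exists_nat_gt (u M / -(u (M + 1) - q * u M))
    rw [div_lt_iff₀ (by linarith)] at hk
    have := key k
    have := hu (M + k)
    linarith
  have hsum : ∀ N, ∑ i ∈ Finset.range N, d i ≤ u 1 - q * u 0 := by
    intro N
    have : ∑ i ∈ Finset.range N, d i = (u 1 - q * u 0) - (u (N + 1) - q * u N) := by
      induction N with
      | zero => simp
      | succ N ih => rw [Finset.sum_range_succ, ih, h N]; ring
    have := hpos N
    linarith
  have hs : Summable d := summable_of_sum_range_le hd hsum
  exact ⟨_, hs.hasSum, Real.tsum_le_of_sum_range_le hd hsum⟩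

theorem aux_defect {H : Type*} [NormedAddCommGroup H] [InnerProductSpace ℂ H] [CompleteSpace H]
    (r : ℝ) (T D : H →L[ℂ] H)
    (hDpos : D.IsPositive) (hDsq : D * D = alphaOp r T) (y : H) :
    ‖D y‖ ^ 2 = (1 + r ^ 2) * ‖T y‖ ^ 2 - ‖T (T y)‖ ^ 2 - r ^ 2 * ‖y‖ ^ 2 := by
  have hm : ∀ (A B : H →L[ℂ] H) (z : H), (A * B) z = A (B z) := fun _ _ _ => rfl
  have h1 : inner ℂ ((D * D) y) y = ((‖D y‖ ^ 2 : ℝ) : ℂ) := by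
    rw [hm, ← ContinuousLinearMap.adjoint_inner_right,
      hDpos.isSelfAdjoint.adjoint_eq, inner_self_eq_norm_sq_to_K]
    simp
  have h2 : inner ℂ ((alphaOp r T) y) y =
      (((1 + r ^ 2) * ‖T y‖ ^ 2 - ‖T (T y)‖ ^ 2 - r ^ 2 * ‖y‖ ^ 2 : ℝ) : ℂ) := by
    simp only [alphaOp, pow_two, ContinuousLinearMap.sub_apply, ContinuousLinearMap.add_apply,
      ContinuousLinearMap.neg_apply, ContinuousLinearMap.smul_apply,
      hm, ContinuousLinearMap.one_apply, inner_sub_left,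
      inner_add_left, inner_neg_left, inner_smul_left, ContinuousLinearMap.adjoint_inner_left,
      inner_self_eq_norm_sq_to_K, Complex.conj_ofReal]
    simp
    ring
  rw [hDsq, h2] at h1
  exact_mod_cast h1.symm

/-- if `T ∈ C_α` (invertible with inverse `S`) with defect operator `D`, then
the output transform is contractive:
`(1-r²)⁻¹ ∑_{n≥0} ‖DTⁿx‖² + (1-r²)⁻¹ ∑_{n≥1} r^{2n-2}‖DT^{-n}x‖² ≤ ‖x‖²` for all `x`
(the second series is indexed by `n : ℕ`, the term of index `n` being
`r^{2n}‖DT^{-(n+1)}x‖²`). -/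
theorem stmt8 {H : Type*} [NormedAddCommGroup H] [InnerProductSpace ℂ H] [CompleteSpace H]
    (r : ℝ) (hr0 : 0 < r) (hr1 : r < 1)
    (T S D : H →L[ℂ] H) (hTS : T * S = 1) (hST : S * T = 1)
    (hDpos : D.IsPositive) (hDsq : D * D = alphaOp r T) :
    ∀ x : H, ∃ Sp Sm : ℝ,
      HasSum (fun n : ℕ => ‖D ((T ^ n) x)‖ ^ 2) Sp ∧
      HasSum (fun n : ℕ => r ^ (2 * n) * ‖D ((S ^ (n + 1)) x)‖ ^ 2) Sm ∧
      (1 - r ^ 2)⁻¹ * Sp + (1 - r ^ 2)⁻¹ * Sm ≤ ‖x‖ ^ 2 := by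
  intro x
  have hTSa : ∀ y, T (S y) = y := fun y =>
    congrArg (fun A : H →L[ℂ] H => A y) hTS
  have hdef := aux_defect r T D hDpos hDsq
  have hTs : ∀ n, (T ^ (n + 1)) x = T ((T ^ n) x) := fun n => by rw [pow_succ']; rfl
  have hSs : ∀ n, (S ^ (n + 1)) x = S ((S ^ n) x) := fun n => by rw [pow_succ']; rfl
  have hr2 : r ^ 2 < 1 := by nlinarith
  obtain ⟨Sp, hSp, hSp'⟩ := aux_tele (r ^ 2) hr2.le (fun n => ‖(T ^ n) x‖ ^ 2)
    (fun n => ‖D ((T ^ n) x)‖ ^ 2) (fun n => by positivity) (fun n => by positivity)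
    (fun n => by simp only [hdef, hTs]; ring)
  obtain ⟨Sq, hSq, hSq'⟩ := aux_tele (r ^ 2) hr2.le (fun n => r ^ (2 * n) * ‖(S ^ n) x‖ ^ 2)
    (fun n => r ^ (2 * (n + 1)) * ‖D ((S ^ (n + 1 + 1)) x)‖ ^ 2)
    (fun n => by positivity) (fun n => by positivity)
    (fun n => by simp only [hdef, hSs, hTSa]; ring)
  have hSm := (hasSum_nat_add_iff (f := fun n : ℕ => r ^ (2 * n) * ‖D ((S ^ (n + 1)) x)‖ ^ 2) 1).1
    hSq
  refine ⟨Sp, _, hSp, hSm, ?_⟩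
  rw [← mul_add, inv_mul_le_iff₀ (by linarith)]
  have e1 : (T ^ 1) x = T x := by rw [pow_one]
  have e2 : (S ^ 1) x = S x := by rw [pow_one]
  simp only [e1, e2, mul_zero, mul_one, pow_zero, one_mul, one_apply_eq_self] at hSp' hSq'
  simp only [Finset.sum_range_one, hdef, zero_add, e2, hTSa, mul_zero, pow_zero, one_mul]
  linarith
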